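/- arXiv:2510.22308 — 2 statements merged into one kernel-verified Lean document; each statement's English description precedes it below -/
import Mathlib

section
/- Let n be a positive even integer. The map φ₁ sending τ₁ to the composition τ₁ ∘ τ₀ is a bijection from b₁(n) onto NC₂^δ(n,−n). -/
open Equiv MeasureTheory ProbabilityTheory

noncomputable section

namespace RibbonNC

/-- The number of cycles `#(σ)` of a permutation, counted on the finite set `S`:
the number of orbits of `σ` meeting `S` (fixed points count as orbits). -/
def cyclesOn {α : Type*} (σ : Equiv.Perm α) (S : Finset α) : ℕ :=
  ((fun a => {b | σ.SameCycle a b}) '' (S : Set α)).ncard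

/-- `σ` is a permutation of `S`: it fixes everything outside `S`. -/
def IsPermOn {α : Type*} (σ : Equiv.Perm α) (S : Finset α) : Prop :=
  ∀ a ∉ S, σ a = a

/-- `σ` is a pairing of `S`: a fixed-point-free involution of `S`, fixing everything
outside `S`. -/
def IsPairingOn {α : Type*} (σ : Equiv.Perm α) (S : Finset α) : Prop :=
  σ * σ = 1 ∧ (∀ a ∈ S, σ a ≠ a) ∧ IsPermOn σ S

/-- `π` is non-crossing with respect to `γ` on `S`: the subgroup generated by `π` and `γ`
acts transitively on `S`, and `#(π) + #(π⁻¹γ) + #(γ) = |S| + 2`. -/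
def IsNoncrossingOn {α : Type*} (π γ : Equiv.Perm α) (S : Finset α) : Prop :=
  (∀ a ∈ S, ∀ b ∈ S, ∃ σ ∈ Subgroup.closure ({π, γ} : Set (Equiv.Perm α)), σ a = b) ∧
  cyclesOn π S + cyclesOn (π⁻¹ * γ) S + cyclesOn γ S = S.card + 2

/-- `[n] = {1, …, n}`, as a finset of integers. -/
def posSet (n : ℕ) : Finset ℤ := Finset.Icc 1 (n : ℤ)

/-- `±[n] = {−n, …, −1} ∪ {1, …, n}`, as a finset of integers. -/
def pmSet (n : ℕ) : Finset ℤ := Finset.Icc (-(n : ℤ)) (n : ℤ) \ {0}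

/-- The cyclic permutation `γ_n = (1, 2, …, n)` of `[n]`. -/
def gammaZ (n : ℕ) : Equiv.Perm ℤ := ((List.range n).map fun i => ((i : ℤ) + 1)).formPerm

/-- The permutation `γ̃_n = (1, 2, …, n)(−n, …, −2, −1)` of `±[n]`. -/
def gammaTildeZ (n : ℕ) : Equiv.Perm ℤ :=
  gammaZ n * ((List.range n).map fun i => ((i : ℤ) - (n : ℤ))).formPerm

/-- The involution `τ₀ : a ↦ −a` on `±[n]`, fixing everything outside. -/
def tau0 (n : ℕ) : Equiv.Perm ℤ :=
  ((List.range n).map fun i => Equiv.swap ((i : ℤ) + 1) (-((i : ℤ) + 1))).prod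

/-- The involution `τ₂` on `±[n]`, pairing `−k` with `k+1` for `1 ≤ k ≤ n−1`, and `−n`
with `1`. -/
def tau2 (n : ℕ) : Equiv.Perm ℤ :=
  ((List.range (n - 1)).map fun i => Equiv.swap (-((i : ℤ) + 1)) ((i : ℤ) + 2)).prod *
    Equiv.swap (-(n : ℤ)) 1

/-- The `δ`-condition for a permutation of `S = ±[n]`: no cycle of the form `(r, −r)`,
and together with every cycle `(r₁, …, r_s)`, the cycle `(−r_s, …, −r₁)` also occurs
(the latter is equivalent to `π(−a) = −π⁻¹(a)` for all `a`). -/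
def IsDeltaOn (π : Equiv.Perm ℤ) (S : Finset ℤ) : Prop :=
  (∀ r ∈ S, ¬(π r = -r ∧ π (-r) = r)) ∧ ∀ a : ℤ, π (-a) = -(π⁻¹ a)

/-- `a_g(n) = {π ∈ P₂(n) : #(π⁻¹γ_n) = n/2 + 1 − 2g}`. -/
def aSet (g n : ℕ) : Set (Equiv.Perm ℤ) :=
  {π | IsPairingOn π (posSet n) ∧ cyclesOn (π⁻¹ * gammaZ n) (posSet n) + 2 * g = n / 2 + 1}

/-- `b_k(n)`. -/
def bSet (k n : ℕ) : Set (Equiv.Perm ℤ) :=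
  {τ₁ | IsPairingOn τ₁ (pmSet n) ∧ cyclesOn (tau2 n * τ₁) (pmSet n) + 2 * k = n + 2 ∧
    tau0 n * τ₁ = τ₁ * tau0 n ∧ (∀ a ∈ pmSet n, (tau0 n * τ₁) a ≠ a) ∧
    ∃ a ∈ posSet n, τ₁ a ∈ posSet n}

/-- `NC₂^δ(n, −n)`, the symmetric non-crossing annular pairings of `±[n]`. -/
def ncDelta2 (n : ℕ) : Set (Equiv.Perm ℤ) :=
  {π | IsPairingOn π (pmSet n) ∧ IsNoncrossingOn π (gammaTildeZ n) (pmSet n) ∧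
    IsDeltaOn π (pmSet n)}

/-- `γ_{n,u,v} = γ_n · (u−1, v)`, with `(0, v)` read as `(n, v)` when `u = 1`. -/
def gammaUV (n : ℕ) (u v : ℤ) : Equiv.Perm ℤ :=
  gammaZ n * Equiv.swap (if u = 1 then (n : ℤ) else u - 1) v

/-- `NC₂^T_{u,v}(n)`. -/
def ncT2uv (n : ℕ) (u v : ℤ) : Set (Equiv.Perm ℤ) :=
  {π | IsPairingOn π (posSet n) ∧ IsNoncrossingOn π (gammaUV n u v) (posSet n) ∧
    π u = v ∧ ∀ a : ℤ, 1 ≤ a → a < u → π a ∈ posSet n ∧ ¬(u ≤ π a ∧ π a ≤ v)}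

/-- `NC₂^T(n)`. -/
def ncT2 (n : ℕ) : Set (Equiv.Perm ℤ) :=
  {π | ∃ u v : ℤ, 1 ≤ u ∧ u < v ∧ v < (n : ℤ) ∧ π ∈ ncT2uv n u v}

/-- `γ̃_{n,u,v} = γ̃_n · (−u, v−1) · (−v, u−1)`, with `(−v, 0)` read as `(−v, n)` when
`u = 1`. -/
def gammaTildeUV (n : ℕ) (u v : ℤ) : Equiv.Perm ℤ :=
  gammaTildeZ n * Equiv.swap (-u) (v - 1) *
    Equiv.swap (-v) (if u = 1 then (n : ℤ) else u - 1)

/-- `NC₂^K_{u,v}(n)`. -/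
def ncK2uv (n : ℕ) (u v : ℤ) : Set (Equiv.Perm ℤ) :=
  {π | IsPairingOn π (pmSet n) ∧ IsNoncrossingOn π (gammaTildeUV n u v) (pmSet n) ∧
    IsDeltaOn π (pmSet n) ∧ π u = -v ∧ ∀ a : ℤ, 1 ≤ a → a < u → π a ∈ posSet n}

/-- `NC₂^K(n)`. -/
def ncK2 (n : ℕ) : Set (Equiv.Perm ℤ) :=
  {π | ∃ u v : ℤ, 1 ≤ u ∧ u < v ∧ v < (n : ℤ) ∧ π ∈ ncK2uv n u v}

/-- The odd elements `{1, 3, …, 2n−1}` of `[2n]`. -/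
def oddPosSet (n : ℕ) : Finset ℤ := (posSet (2 * n)).filter fun a => Odd a

/-- `ã_{g,p}(n)`. -/
def aTildeSet (g p n : ℕ) : Set (Equiv.Perm ℤ) :=
  {π | π ∈ aSet g (2 * n) ∧ (∀ a ∈ posSet (2 * n), Even a → Odd (π a)) ∧
    cyclesOn (π⁻¹ * gammaZ (2 * n)) (oddPosSet n) = p}

/-- `B(n) = {1, 3, …, 2n−1} ∪ {−2, −4, …, −2n} ⊂ ±[2n]`. -/
def BSet (n : ℕ) : Finset ℤ :=
  (pmSet (2 * n)).filter fun a => (0 < a ∧ Odd a) ∨ (a < 0 ∧ Even a)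

/-- `W(n) = {2, 4, …, 2n} ∪ {−1, −3, …, −(2n−1)} ⊂ ±[2n]`. -/
def WSet (n : ℕ) : Finset ℤ :=
  (pmSet (2 * n)).filter fun a => (0 < a ∧ Even a) ∨ (a < 0 ∧ Odd a)

/-- `b̃_{k,p}(n)`. -/
def bTildeSet (k p n : ℕ) : Set (Equiv.Perm ℤ) :=
  {τ₁ | τ₁ ∈ bSet k (2 * n) ∧ (∀ a ∈ BSet n, τ₁ a ∈ BSet n) ∧
    cyclesOn (tau2 (2 * n) * τ₁) (WSet n) = 2 * p}

/-- `â_{g,p}(n) = {π ∈ S_{[n]} : #(π) = p, #(π⁻¹γ_n) = n − p + 1 − 2g}`. -/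
def aHatSet (g p n : ℕ) : Set (Equiv.Perm ℤ) :=
  {π | IsPermOn π (posSet n) ∧ cyclesOn π (posSet n) = p ∧
    cyclesOn (π⁻¹ * gammaZ n) (posSet n) + p + 2 * g = n + 1}

/-- `b̂_{k,p}(n)`. -/
def bHatSet (k p n : ℕ) : Set (Equiv.Perm ℤ) :=
  {τ₁ | IsPermOn τ₁ (pmSet n) ∧ cyclesOn τ₁ (pmSet n) = 2 * p ∧
    cyclesOn (gammaTildeZ n * τ₁) (pmSet n) + 2 * p + 2 * k = 2 * n + 2 ∧
    tau0 n * τ₁ * tau0 n = τ₁⁻¹ ∧ (∀ a ∈ pmSet n, (tau0 n * τ₁) a ≠ a) ∧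
    ∃ a ∈ posSet n, -(τ₁ a) ∈ posSet n}

/-- `ÑC₂^{δ,p}(2n, −2n)`. -/
def ncDelta2Tilde (p n : ℕ) : Set (Equiv.Perm ℤ) :=
  {π | π ∈ ncDelta2 (2 * n) ∧ (∀ a ∈ WSet n, π a ∈ BSet n) ∧
    cyclesOn (π⁻¹ * gammaTildeZ (2 * n)) (BSet n) = 2 * p}

/-- `ÑC₂^{T,p}(2n)`. -/
def ncT2Tilde (p n : ℕ) : Set (Equiv.Perm ℤ) :=
  {π | ∃ u v : ℤ, 1 ≤ u ∧ u < v ∧ v < (2 * n : ℤ) ∧ Odd (v - u) ∧ π ∈ ncT2uv (2 * n) u v ∧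
    (∀ a ∈ posSet (2 * n), Even a → Odd (π a)) ∧
    cyclesOn (π⁻¹ * gammaZ (2 * n)) (oddPosSet n) = p}

/-- `ÑC₂^{K,p}(2n)`. -/
def ncK2Tilde (p n : ℕ) : Set (Equiv.Perm ℤ) :=
  {π | ∃ u v : ℤ, 1 ≤ u ∧ u < v ∧ v < (2 * n : ℤ) ∧ Even (v - u) ∧ π ∈ ncK2uv (2 * n) u v ∧
    (∀ a ∈ WSet n, π a ∈ BSet n) ∧
    cyclesOn (π⁻¹ * gammaTildeZ (2 * n)) (BSet n) = 2 * p}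

/-- `NC^{T,p}(n)` (non-crossing annular permutations, toroidal case). -/
def ncTPerm (p n : ℕ) : Set (Equiv.Perm ℤ) :=
  {π | ∃ u v : ℤ, 1 ≤ u ∧ u < v ∧ v < (n : ℤ) ∧ IsPermOn π (posSet n) ∧
    IsNoncrossingOn π (gammaUV n u v) (posSet n) ∧ π⁻¹ u = v ∧
    cyclesOn π (posSet n) = p ∧
    ∀ a : ℤ, 1 ≤ a → a < u → π⁻¹ a ∈ posSet n ∧ ¬(u ≤ π⁻¹ a ∧ π⁻¹ a ≤ v)}

/-- `NC^{δ,p}(n, −n)` (symmetric non-crossing annular permutations). -/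
def ncDeltaPerm (p n : ℕ) : Set (Equiv.Perm ℤ) :=
  {π | IsPermOn π (pmSet n) ∧ IsNoncrossingOn π (gammaTildeZ n) (pmSet n) ∧
    IsDeltaOn π (pmSet n) ∧ cyclesOn π (pmSet n) = 2 * p}

/-- `NC^{K,p}(n)` (non-crossing annular permutations, Klein bottle case). -/
def ncKPerm (p n : ℕ) : Set (Equiv.Perm ℤ) :=
  {π | ∃ u v : ℤ, 1 ≤ u ∧ u < v ∧ v < (n : ℤ) ∧ IsPermOn π (pmSet n) ∧
    IsNoncrossingOn π (gammaTildeUV n u v) (pmSet n) ∧ IsDeltaOn π (pmSet n) ∧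
    π u = -v ∧ cyclesOn π (pmSet n) = 2 * p ∧
    ∀ a : ℤ, 1 ≤ a → a < u → π⁻¹ a ∈ posSet n}


lemma perm_gen_preserve {S : Set (Equiv.Perm ℤ)} {P : ℤ → Prop}
    (h : ∀ σ ∈ S, ∀ a, P (σ a) ↔ P a) {σ : Equiv.Perm ℤ} (hσ : σ ∈ Subgroup.closure S) :
    ∀ a, P (σ a) ↔ P a := by
  induction hσ using Subgroup.closure_induction with
  | mem x hx => exact h x hx
  | one => intro a; simp
  | mul x y _ _ hx hy => intro a; rw [Equiv.Perm.mul_apply, hx, hy]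
  | inv x _ hx => intro a; rw [← hx (x⁻¹ a)]; simp

lemma sameCycle_preserve {f : Equiv.Perm ℤ} {P : ℤ → Prop}
    (h : ∀ a, P (f a) ↔ P a) {a b : ℤ} (hab : f.SameCycle a b) : P b ↔ P a := by
  obtain ⟨i, rfl⟩ := hab
  refine perm_gen_preserve (S := {f}) (by simpa using h) ?_ a
  exact Subgroup.zpow_mem _ (Subgroup.subset_closure (by simp)) i

lemma cyclesOn_inv {α : Type*} (σ : Equiv.Perm α) (S : Finset α) :
    cyclesOn σ⁻¹ S = cyclesOn σ S := by
  simp [cyclesOn, Equiv.Perm.sameCycle_inv]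

lemma cyclesOn_conj {α : Type*} (g σ : Equiv.Perm α) (S : Finset α)
    (h : ∀ a ∈ S, g a ∈ S) (h' : ∀ a ∈ S, g⁻¹ a ∈ S) :
    cyclesOn (g * σ * g⁻¹) S = cyclesOn σ S := by
  unfold cyclesOn
  rw [← Set.ncard_image_of_injective ((fun a => {b | σ.SameCycle a b}) '' (S : Set α))
    (Set.image_injective.2 g.injective)]
  congr 1
  have key : ∀ x, {b | (g * σ * g⁻¹).SameCycle x b} = g '' {b | σ.SameCycle (g⁻¹ x) b} := by
    intro x
    ext b
    simp only [Set.mem_ofPred_eq, Equiv.Perm.sameCycle_conj, Set.mem_image]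
    constructor
    · intro hb; exact ⟨g⁻¹ b, hb, by simp⟩
    · rintro ⟨c, hc, rfl⟩; simpa using hc
  ext T
  constructor
  · rintro ⟨x, hx, rfl⟩
    exact ⟨_, ⟨g⁻¹ x, h' x hx, rfl⟩, (key x).symm⟩
  · rintro ⟨_, ⟨x, hx, rfl⟩, rfl⟩
    exact ⟨g x, h x hx, (key (g x)).trans (by simp)⟩

lemma sameCycle_invol {α : Type*} {σ : Equiv.Perm α} (h : σ * σ = 1) (a b : α) :
    σ.SameCycle a b ↔ b = a ∨ b = σ a := by
  constructor
  · rintro ⟨i, rfl⟩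
    rcases Int.even_or_odd' i with ⟨k, rfl | rfl⟩
    · left
      rw [zpow_mul, zpow_ofNat, pow_two, h]; simp
    · right
      rw [zpow_add, zpow_mul, zpow_ofNat, pow_two, h]; simp
  · rintro (rfl | rfl)
    · exact Equiv.Perm.SameCycle.refl _ _
    · exact ⟨1, by simp⟩

lemma cyclesOn_pairing {α : Type*} {σ : Equiv.Perm α} {S : Finset α}
    (h : IsPairingOn σ S) : S.card = cyclesOn σ S * 2 := by
  classical
  obtain ⟨h1, h2, h3⟩ := h
  have hinv : ∀ a, σ (σ a) = a := fun a => by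
    rw [← Equiv.Perm.mul_apply, h1]; rfl
  have hS : ∀ a ∈ S, σ a ∈ S := by
    intro a ha
    by_contra hc
    have := h3 _ hc
    exact h2 a ha (σ.injective this)
  unfold cyclesOn
  rw [← Finset.coe_image, Set.ncard_coe_finset,
    Finset.card_eq_sum_card_image (fun a => {b | σ.SameCycle a b}) S]
  apply Finset.sum_const_nat
  intro T hT
  obtain ⟨x, hx, rfl⟩ := Finset.mem_image.1 hT
  have : S.filter (fun a => {b | σ.SameCycle a b} = {b | σ.SameCycle x b}) = {x, σ x} := by
    ext a
    simp only [Finset.mem_filter, Finset.mem_insert, Finset.mem_singleton]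
    rw [← sameCycle_invol h1]
    constructor
    · rintro ⟨_, he⟩
      have : a ∈ {b | σ.SameCycle a b} := Equiv.Perm.SameCycle.refl _ _
      rw [he] at this; exact this
    · intro he
      refine ⟨?_, ?_⟩
      · rcases (sameCycle_invol h1 _ _).1 he with rfl | rfl
        · exact hx
        · exact hS _ hx
      · ext b
        exact ⟨fun hb => he.trans hb, fun hb => he.symm.trans hb⟩
  rw [this, Finset.card_pair (h2 x hx).symm]

lemma tau0_apply (n : ℕ) (a : ℤ) :
    tau0 n a = if -(n : ℤ) ≤ a ∧ a ≤ n then -a else a := by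
  induction n generalizing a with
  | zero => simp [tau0]; omega
  | succ n ih =>
    have : tau0 (n + 1) = tau0 n * Equiv.swap ((n : ℤ) + 1) (-((n : ℤ) + 1)) := by
      simp [tau0, List.range_succ]
    rw [this, Equiv.Perm.mul_apply, ih, Equiv.swap_apply_def]
    push_cast
    split_ifs <;> omega

lemma cast_list {β : Type*} (n : ℕ) (f : ℤ → β) :
    List.map f (do let a ← List.range n; pure (a : ℤ)) =
      (List.range n).map (fun i : ℕ => f (i : ℤ)) := by
  simp only [List.bind_eq_flatMap, List.pure_def, List.map_flatMap, List.map_cons, List.map_nil]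
  rw [List.map_eq_flatMap]

lemma tau2_aux (m : ℕ) (a : ℤ) :
    ((List.range m).map fun i : ℕ => Equiv.swap (-((i : ℤ) + 1)) ((i : ℤ) + 2)).prod a =
      if -(m : ℤ) ≤ a ∧ a ≤ -1 then -a + 1 else if 2 ≤ a ∧ a ≤ m + 1 then -a + 1 else a := by
  induction m generalizing a with
  | zero => simp; omega
  | succ n ih =>
    rw [List.range_succ, List.map_append, List.prod_append, Equiv.Perm.mul_apply, ih]
    simp only [List.map_cons, List.map_nil, List.prod_singleton]
    rw [Equiv.swap_apply_def]
    push_cast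
    split_ifs <;> omega

lemma tau2_apply (n : ℕ) (hn : 0 < n) (a : ℤ) :
    tau2 n a = if a = 1 then -(n : ℤ) else if a = -(n : ℤ) then 1 else
      if -(n : ℤ) < a ∧ a ≤ -1 then -a + 1 else if 2 ≤ a ∧ a ≤ n then -a + 1 else a := by
  unfold tau2
  rw [cast_list, Equiv.Perm.mul_apply, tau2_aux, Equiv.swap_apply_def]
  have : ((n - 1 : ℕ) : ℤ) = n - 1 := by omega
  rw [this]
  clear this
  split_ifs <;> omega

lemma formPerm_interval (f : ℕ → ℤ) (c : ℤ) (hf : ∀ i, f i = i + c) (n : ℕ) (hn : 0 < n) (a : ℤ) :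
    ((List.range n).map f).formPerm a =
      if c ≤ a ∧ a < c + n - 1 then a + 1 else if a = c + n - 1 then c else a := by
  have hnd : ((List.range n).map f).Nodup := by
    refine List.Nodup.map ?_ List.nodup_range
    intro i j hij
    rw [hf, hf] at hij
    omega
  by_cases ha : c ≤ a ∧ a < c + n
  · obtain ⟨k, rfl⟩ : ∃ k : ℕ, a = k + c := ⟨(a - c).toNat, by omega⟩
    have hk : k < n := by omega
    have := List.formPerm_apply_getElem _ hnd k (by simpa using hk)
    simp only [List.getElem_map, List.getElem_range, hf, List.length_map, List.length_range] at this
    have hfe : f = fun i : ℕ => (i : ℤ) + c := funext hf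
    rw [hfe] at this ⊢
    rw [this]
    by_cases hk' : k + 1 = n
    · rw [hk', Nat.mod_self]
      split_ifs <;> push_cast <;> omega
    · rw [Nat.mod_eq_of_lt (by omega)]
      split_ifs <;> push_cast <;> omega
  · rw [List.formPerm_apply_of_notMem]
    · split_ifs <;> omega
    · simp only [List.mem_map, List.mem_range, hf, not_exists, not_and]
      intro i hi; omega

lemma gammaTildeZ_apply (n : ℕ) (hn : 0 < n) (a : ℤ) :
    gammaTildeZ n a = if a = n then 1 else if a = -1 then -(n : ℤ) else
      if (1 ≤ a ∧ a < n) ∨ (-(n : ℤ) ≤ a ∧ a < -1) then a + 1 else a := by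
  unfold gammaTildeZ gammaZ
  rw [cast_list, cast_list, Equiv.Perm.mul_apply, formPerm_interval _ 1 (fun _ => rfl) n hn,
    formPerm_interval _ (-(n : ℤ)) (fun _ => by ring) n hn]
  split_ifs <;> omega

lemma gammaTildeZ_eq (n : ℕ) (hn : 0 < n) : gammaTildeZ n = tau2 n * tau0 n := by
  ext a
  rw [Equiv.Perm.mul_apply, gammaTildeZ_apply n hn, tau2_apply n hn, tau0_apply]
  split_ifs <;> omega

lemma mem_pm (n : ℕ) (a : ℤ) : a ∈ pmSet n ↔ (-(n : ℤ) ≤ a ∧ a ≤ n) ∧ a ≠ 0 := by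
  simp [pmSet]

lemma mem_pos (n : ℕ) (a : ℤ) : a ∈ posSet n ↔ 1 ≤ a ∧ a ≤ n := by
  simp [posSet]

lemma card_pm (n : ℕ) : (pmSet n).card = 2 * n := by
  unfold pmSet
  rw [Finset.card_sdiff_of_subset (by simp), Int.card_Icc]
  simp; omega

lemma tau0_sq (n : ℕ) : tau0 n * tau0 n = 1 := by
  ext a
  rw [Equiv.Perm.mul_apply, tau0_apply, tau0_apply, Equiv.Perm.one_apply]
  split_ifs <;> omega

lemma tau2_sq (n : ℕ) (hn : 0 < n) : tau2 n * tau2 n = 1 := by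
  ext a
  rw [Equiv.Perm.mul_apply, tau2_apply n hn, tau2_apply n hn, Equiv.Perm.one_apply]
  split_ifs <;> omega

lemma gamma_pos (n : ℕ) (hn : 0 < n) (a : ℤ) :
    gammaTildeZ n a ∈ posSet n ↔ a ∈ posSet n := by
  rw [gammaTildeZ_apply n hn, mem_pos, mem_pos]
  split_ifs <;> omega

lemma gamma_neg (n : ℕ) (hn : 0 < n) (a : ℤ) :
    (-(n : ℤ) ≤ gammaTildeZ n a ∧ gammaTildeZ n a ≤ -1) ↔ (-(n : ℤ) ≤ a ∧ a ≤ -1) := by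
  rw [gammaTildeZ_apply n hn]
  split_ifs <;> omega

lemma gamma_same_pos (n : ℕ) (hn : 0 < n) (k : ℕ) (hk : k < n) :
    (gammaTildeZ n).SameCycle 1 (k + 1) := by
  induction k with
  | zero => simp [Equiv.Perm.SameCycle.refl]
  | succ k ih =>
    have := ih (by omega)
    have h2 : gammaTildeZ n ((k : ℤ) + 1) = ((k + 1 : ℕ) : ℤ) + 1 := by
      rw [gammaTildeZ_apply n hn]; push_cast; split_ifs <;> omega
    rw [← h2]
    exact Equiv.Perm.sameCycle_apply_right.2 this

lemma gamma_same_neg (n : ℕ) (hn : 0 < n) (k : ℕ) (hk : k < n) :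
    (gammaTildeZ n).SameCycle (-n) (k - n) := by
  induction k with
  | zero => simp [Equiv.Perm.SameCycle.refl]
  | succ k ih =>
    have := ih (by omega)
    have h2 : gammaTildeZ n ((k : ℤ) - n) = ((k + 1 : ℕ) : ℤ) - n := by
      rw [gammaTildeZ_apply n hn]; push_cast; split_ifs <;> omega
    rw [← h2]
    exact Equiv.Perm.sameCycle_apply_right.2 this

lemma gamma_same_pos' (n : ℕ) (hn : 0 < n) (a : ℤ) (ha : a ∈ posSet n) :
    (gammaTildeZ n).SameCycle 1 a := by
  rw [mem_pos] at ha
  have := gamma_same_pos n hn (a - 1).toNat (by omega)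
  rwa [show (((a - 1).toNat : ℕ) : ℤ) + 1 = a by omega] at this

lemma gamma_same_neg' (n : ℕ) (hn : 0 < n) (a : ℤ) (ha : -(n : ℤ) ≤ a ∧ a ≤ -1) :
    (gammaTildeZ n).SameCycle (-n) a := by
  have := gamma_same_neg n hn (a + n).toNat (by omega)
  rwa [show (((a + n).toNat : ℕ) : ℤ) - n = a by omega] at this

lemma cyclesOn_gamma (n : ℕ) (hn : 0 < n) : cyclesOn (gammaTildeZ n) (pmSet n) = 2 := by
  have hset : ∀ {x a}, (gammaTildeZ n).SameCycle x a →
      {b | (gammaTildeZ n).SameCycle a b} = {b | (gammaTildeZ n).SameCycle x b} := by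
    intro x a h
    ext b
    exact ⟨fun hb => h.trans hb, fun hb => h.symm.trans hb⟩
  have : (fun a => {b | (gammaTildeZ n).SameCycle a b}) '' (pmSet n : Set ℤ) =
      {{b | (gammaTildeZ n).SameCycle 1 b}, {b | (gammaTildeZ n).SameCycle (-(n : ℤ)) b}} := by
    ext T
    simp only [Set.mem_image, Finset.mem_coe, Set.mem_insert_iff, Set.mem_singleton_iff]
    constructor
    · rintro ⟨a, ha, rfl⟩
      rw [mem_pm] at ha
      rcases lt_or_gt_of_ne ha.2 with h | h
      · right; exact hset (gamma_same_neg' n hn a (by omega))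
      · left; exact hset (gamma_same_pos' n hn a (by rw [mem_pos]; omega))
    · rintro (rfl | rfl)
      · exact ⟨1, by rw [mem_pm]; omega, rfl⟩
      · exact ⟨-n, by rw [mem_pm]; omega, rfl⟩
  unfold cyclesOn
  rw [this, Set.ncard_pair]
  intro h
  have h1 : (1 : ℤ) ∈ {b | (gammaTildeZ n).SameCycle (-(n : ℤ)) b} := by
    rw [← h]; exact Equiv.Perm.SameCycle.refl _ _
  have := sameCycle_preserve (P := fun a => a ∈ posSet n) (gamma_pos n hn) h1
  rw [mem_pos, mem_pos] at this
  omega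

lemma tau0_pm (n : ℕ) (a : ℤ) (ha : a ∈ pmSet n) : tau0 n a = -a := by
  rw [tau0_apply, if_pos ((mem_pm n a).1 ha).1]

lemma neg_pm (n : ℕ) (a : ℤ) : -a ∈ pmSet n ↔ a ∈ pmSet n := by
  rw [mem_pm, mem_pm]; omega

lemma tau0_inv (n : ℕ) : (tau0 n)⁻¹ = tau0 n := inv_eq_of_mul_eq_one_left (tau0_sq n)

/-- The cycle count of `π⁻¹ γ̃` agrees with the one of `τ₂ τ₁`. -/
lemma cycles_key (n : ℕ) (hn : 0 < n) (τ : Equiv.Perm ℤ) (h1 : τ * τ = 1) :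
    cyclesOn ((τ * tau0 n)⁻¹ * gammaTildeZ n) (pmSet n) = cyclesOn (tau2 n * τ) (pmSet n) := by
  have e : (τ * tau0 n)⁻¹ * gammaTildeZ n = tau0 n * (tau2 n * τ)⁻¹ * (tau0 n)⁻¹ := by
    rw [gammaTildeZ_eq n hn, mul_inv_rev, mul_inv_rev, tau0_inv,
      inv_eq_of_mul_eq_one_left (tau2_sq n hn)]
    simp only [mul_assoc]
  rw [e, cyclesOn_conj, cyclesOn_inv]
  · intro a ha; rwa [tau0_pm n a ha, neg_pm]
  · intro a ha; rwa [tau0_inv, tau0_pm n a ha, neg_pm]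

lemma pairing_maps {α : Type*} {σ : Equiv.Perm α} {S : Finset α} (h : IsPairingOn σ S)
    (a : α) (ha : a ∈ S) : σ a ∈ S := by
  by_contra hc
  exact h.2.1 a ha (σ.injective (h.2.2 _ hc))

lemma zero_not_pm (n : ℕ) (a : ℤ) (ha : a ∉ pmSet n) : tau0 n a = a := by
  rw [tau0_apply]
  rw [mem_pm] at ha
  split_ifs <;> omega

lemma forward (n : ℕ) (hn : 0 < n) (τ : Equiv.Perm ℤ) (h : τ ∈ bSet 1 n) :
    τ * tau0 n ∈ ncDelta2 n := by
  obtain ⟨hp, hc, hcomm, hfp, x, hx, hx'⟩ := h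
  have hsq : (τ * tau0 n) * (τ * tau0 n) = 1 := by
    calc (τ * tau0 n) * (τ * tau0 n) = τ * (tau0 n * τ) * tau0 n := by simp only [mul_assoc]
      _ = (τ * τ) * (tau0 n * tau0 n) := by rw [hcomm]; simp only [mul_assoc]
      _ = 1 := by rw [hp.1, tau0_sq, one_mul]
  have hpi : IsPairingOn (τ * tau0 n) (pmSet n) := by
    refine ⟨hsq, ?_, ?_⟩
    · intro a ha; rw [← hcomm]; exact hfp a ha
    · intro a ha
      rw [Equiv.Perm.mul_apply, zero_not_pm n a ha, hp.2.2 a ha]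
  have hπ : ∀ a ∈ pmSet n, (τ * tau0 n) a = τ (-a) := by
    intro a ha; rw [Equiv.Perm.mul_apply, tau0_pm n a ha]
  have hneg : ∀ a ∈ pmSet n, τ (-a) = - τ a := by
    intro a ha
    rw [← hπ a ha, ← hcomm, Equiv.Perm.mul_apply, tau0_pm n _ (pairing_maps hp a ha)]
  refine ⟨hpi, ⟨?_, ?_⟩, ?_, ?_⟩
  · -- transitivity: everything is reachable from `1`
    have hg : gammaTildeZ n ∈ Subgroup.closure ({τ * tau0 n, gammaTildeZ n} : Set (Equiv.Perm ℤ)) :=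
      Subgroup.subset_closure (by simp)
    have hpm : τ * tau0 n ∈ Subgroup.closure ({τ * tau0 n, gammaTildeZ n} : Set (Equiv.Perm ℤ)) :=
      Subgroup.subset_closure (by simp)
    have hsame : ∀ {a b : ℤ}, (gammaTildeZ n).SameCycle a b → ∃ σ ∈ Subgroup.closure
        ({τ * tau0 n, gammaTildeZ n} : Set (Equiv.Perm ℤ)), σ a = b := by
      rintro a b ⟨i, hi⟩
      exact ⟨_, Subgroup.zpow_mem _ hg i, hi⟩
    have hfrom : ∀ b ∈ pmSet n, ∃ σ ∈ Subgroup.closure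
        ({τ * tau0 n, gammaTildeZ n} : Set (Equiv.Perm ℤ)), σ 1 = b := by
      intro b hb
      rw [mem_pm] at hb
      rcases lt_or_gt_of_ne hb.2 with h | h
      · rw [mem_pos] at hx
        have hxm : x ∈ pmSet n := by rw [mem_pm]; omega
        obtain ⟨s1, hs1, e1⟩ := hsame (gamma_same_pos' n hn _ hx')
        obtain ⟨s2, hs2, e2⟩ := hsame ((gamma_same_neg' n hn (-x) (by omega)).symm.trans
          (gamma_same_neg' n hn b (by omega)))
        refine ⟨s2 * ((τ * tau0 n) * s1), Subgroup.mul_mem _ hs2 (Subgroup.mul_mem _ hpm hs1), ?_⟩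
        have hh : (τ * tau0 n) (τ x) = -x := by
          rw [hπ _ (pairing_maps hp x hxm), hneg _ (pairing_maps hp x hxm),
            ← Equiv.Perm.mul_apply, hp.1, Equiv.Perm.one_apply]
        rw [Equiv.Perm.mul_apply, Equiv.Perm.mul_apply, e1, hh, e2]
      · exact hsame (gamma_same_pos' n hn b (by rw [mem_pos]; omega))
    intro a ha b hb
    obtain ⟨s, hs, rfl⟩ := hfrom a ha
    obtain ⟨t, ht, rfl⟩ := hfrom b hb
    exact ⟨t * s⁻¹, Subgroup.mul_mem _ ht (Subgroup.inv_mem _ hs), by simp⟩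
  · rw [cycles_key n hn τ hp.1, cyclesOn_gamma n hn]
    have := cyclesOn_pairing hpi
    rw [card_pm] at this ⊢
    omega
  · rintro r hr ⟨-, h2⟩
    rw [hπ (-r) ((neg_pm n r).2 hr), neg_neg] at h2
    exact hp.2.1 r hr h2
  · intro a
    rw [inv_eq_of_mul_eq_one_left hsq]
    by_cases ha : a ∈ pmSet n
    · rw [hπ _ ((neg_pm n a).2 ha), hπ a ha, hneg a ha, neg_neg, neg_neg]
    · rw [hpi.2.2 a ha, hpi.2.2 (-a) (fun h => ha ((neg_pm n a).1 h))]

lemma backward (n : ℕ) (hn : 0 < n) (π : Equiv.Perm ℤ) (h : π ∈ ncDelta2 n) :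
    π * tau0 n ∈ bSet 1 n := by
  obtain ⟨hp, ⟨htr, hc⟩, hd1, hd2⟩ := h
  have hinv : π⁻¹ = π := inv_eq_of_mul_eq_one_left hp.1
  rw [hinv] at hd2
  have hcomm : tau0 n * π = π * tau0 n := by
    ext a
    rw [Equiv.Perm.mul_apply, Equiv.Perm.mul_apply]
    by_cases ha : a ∈ pmSet n
    · rw [tau0_pm n a ha, tau0_pm n _ (pairing_maps hp a ha), hd2]
    · rw [hp.2.2 a ha, zero_not_pm n a ha, hp.2.2 a ha]
  have hcancel : π * tau0 n * tau0 n = π := by rw [mul_assoc, tau0_sq, mul_one]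
  have hsq : (π * tau0 n) * (π * tau0 n) = 1 := by
    calc (π * tau0 n) * (π * tau0 n) = π * (tau0 n * π) * tau0 n := by simp only [mul_assoc]
      _ = (π * π) * (tau0 n * tau0 n) := by rw [hcomm]; simp only [mul_assoc]
      _ = 1 := by rw [hp.1, tau0_sq, one_mul]
  have hτ : ∀ a ∈ pmSet n, (π * tau0 n) a = -π a := by
    intro a ha; rw [Equiv.Perm.mul_apply, tau0_pm n a ha, hd2]
  have hkey := cycles_key n hn _ hsq
  rw [hcancel] at hkey
  refine ⟨⟨hsq, ?_, ?_⟩, ?_, ?_, ?_, ?_⟩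
  · intro a ha he
    rw [hτ a ha] at he
    exact hd1 a ha ⟨by omega, by rw [hd2]; exact he⟩
  · intro a ha
    rw [Equiv.Perm.mul_apply, zero_not_pm n a ha, hp.2.2 a ha]
  · rw [← hkey]
    have := cyclesOn_pairing hp
    rw [cyclesOn_gamma n hn] at hc
    rw [card_pm] at this hc
    omega
  · rw [← mul_assoc, hcomm]
  · intro a ha
    rw [← mul_assoc, hcomm, hcancel]
    exact hp.2.1 a ha
  · by_contra hno
    push Not at hno
    have hpos : ∀ a ∈ posSet n, π a ∈ posSet n := by
      intro a ha
      have ham : a ∈ pmSet n := by rw [mem_pos] at ha; rw [mem_pm]; omega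
      have h1 := hno a ha
      have h2 := pairing_maps hp a ham
      rw [hτ a ham, mem_pos] at h1
      rw [mem_pm] at h2
      rw [mem_pos]; omega
    have hpp : ∀ a, π (π a) = a := fun a => by
      rw [← Equiv.Perm.mul_apply, hp.1]; rfl
    obtain ⟨σ, hσ, he⟩ := htr 1 (by rw [mem_pm]; omega) (-1) (by rw [mem_pm]; omega)
    have := perm_gen_preserve (P := fun a => a ∈ posSet n) (S := {π, gammaTildeZ n}) (by
      rintro s (rfl | rfl)
      · intro a
        exact ⟨fun h => by simpa [hpp] using hpos _ h, hpos a⟩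
      · exact gamma_pos n hn) hσ 1
    rw [he, mem_pos, mem_pos] at this
    omega

/-- For `n` a positive even integer, the map `φ₁ : τ₁ ↦ τ₁ ∘ τ₀` is a
bijection from `b₁(n)` onto `NC₂^δ(n, −n)`. -/
theorem bijection_b1_ncDelta2 (n : ℕ) (hn : 0 < n) (hne : Even n) :
    Set.BijOn (fun τ₁ => τ₁ * tau0 n) (bSet 1 n) (ncDelta2 n) := by
  refine ⟨fun τ h => forward n hn τ h, fun a _ b _ hab => mul_right_cancel hab, ?_⟩
  intro π hπ
  refine ⟨π * tau0 n, backward n hn π hπ, ?_⟩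
  simp only [mul_assoc, tau0_sq, mul_one]

end RibbonNC
end
end

section
/- Let n be a positive even integer. Then, as subsets of P₂(n), a₁(n) = NC₂^T(n). -/
open Equiv MeasureTheory ProbabilityTheory

noncomputable section

namespace RibbonNC

@[simp]
theorem sc_rfl {α : Type*} (σ : Equiv.Perm α) (a : α) : σ.SameCycle a a :=
  Equiv.Perm.SameCycle.refl _ _

theorem gammaZ_eq (n : ℕ) :
    gammaZ n = ((List.range n).map fun i : ℕ => ((i : ℤ) + 1)).formPerm := by
  unfold gammaZ
  congr 1
  change List.map _ (List.flatMap (fun a : ℕ => [(a : ℤ)]) (List.range n)) = _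
  rw [← List.map_eq_flatMap, List.map_map]
  rfl

theorem gammaZ_lt (n : ℕ) (i : ℤ) (h1 : 1 ≤ i) (h2 : i < n) : gammaZ n i = i + 1 := by
  obtain ⟨k, rfl⟩ : ∃ k : ℕ, i = k + 1 := ⟨(i - 1).toNat, by omega⟩
  have hnd : ((List.range n).map fun i : ℕ => ((i : ℤ) + 1)).Nodup := by
    refine List.Nodup.map ?_ List.nodup_range
    intro a b h
    simpa using h
  have := List.formPerm_apply_getElem _ hnd k (by simp; omega)
  have hm : (k + 1) % n = k + 1 := Nat.mod_eq_of_lt (by omega)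
  simp [hm] at this
  rw [gammaZ_eq]
  simpa using this

theorem gammaZ_last (n : ℕ) (h : 0 < n) : gammaZ n n = 1 := by
  obtain ⟨k, rfl⟩ : ∃ k : ℕ, n = k + 1 := ⟨n - 1, by omega⟩
  have hnd : ((List.range (k+1)).map fun i : ℕ => ((i : ℤ) + 1)).Nodup := by
    refine List.Nodup.map ?_ List.nodup_range
    intro a b h
    simpa using h
  have := List.formPerm_apply_getElem _ hnd k (by simp)
  simp at this
  rw [gammaZ_eq]
  simpa using this

theorem sc_lift {α β : Type*} (σ : Equiv.Perm α) (τ : Equiv.Perm β) (f : α → β)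
    (h : ∀ a, τ.SameCycle (f a) (f (σ a))) {a b : α} (hab : σ.SameCycle a b) :
    τ.SameCycle (f a) (f b) := by
  obtain ⟨k, rfl⟩ := hab
  induction k using Int.induction_on with
  | zero => exact Equiv.Perm.SameCycle.refl _ _
  | succ k ih =>
    have := h ((σ ^ (k : ℤ)) a)
    rw [add_comm, zpow_one_add, Equiv.Perm.mul_apply]
    exact ih.trans this
  | pred k ih =>
    have := h ((σ ^ (-(k : ℤ) - 1)) a)
    rw [← Equiv.Perm.mul_apply, ← zpow_one_add, show (1 + (-(k : ℤ) - 1)) = -k by ring] at this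
    exact ih.trans this.symm

theorem sc_invariant {α : Type*} (σ : Equiv.Perm α) (S : Finset α)
    (h : ∀ a ∈ S, σ a ∈ S) {a b : α} (hab : σ.SameCycle a b) (ha : a ∈ S) : b ∈ S := by
  have h' : ∀ a, σ a ∈ S ↔ a ∈ S := by
    have hm : S.map σ.toEmbedding = S := by
      apply Finset.eq_of_subset_of_card_le
      · intro x hx
        simp only [Finset.mem_map, Equiv.coe_toEmbedding] at hx
        obtain ⟨y, hy, rfl⟩ := hx
        exact h y hy
      · simp
    intro a
    constructor
    · intro hs
      rw [← hm] at hs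
      simpa using hs
    · exact h a
  obtain ⟨k, rfl⟩ := hab
  induction k using Int.induction_on with
  | zero => simpa
  | succ k ih =>
    rw [add_comm, zpow_one_add, Equiv.Perm.mul_apply, h']
    exact ih
  | pred k ih =>
    rw [← h', ← Equiv.Perm.mul_apply, ← zpow_one_add, show (1 + (-(k : ℤ) - 1)) = -k by ring]
    exact ih

theorem cls_eq {α : Type*} (σ : Equiv.Perm α) (a b : α) :
    ({c | σ.SameCycle a c} = {c | σ.SameCycle b c}) ↔ σ.SameCycle a b := by
  constructor
  · intro h
    have : b ∈ {c | σ.SameCycle b c} := Equiv.Perm.SameCycle.refl _ _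
    rw [← h] at this
    exact this
  · intro h
    ext c
    exact ⟨fun h' => h.symm.trans h', fun h' => h.trans h'⟩

theorem ncard_le_of_ker {α β γ : Type*} (S : Set α) (hS : S.Finite) (f : α → β) (g : α → γ)
    (h : ∀ a ∈ S, ∀ b ∈ S, g a = g b → f a = f b) : (f '' S).ncard ≤ (g '' S).ncard := by
  classical
  rcases S.eq_empty_or_nonempty with rfl | ⟨s, hs⟩
  · simp
  have key : ∀ c : γ, ∃ d : β, ∀ a ∈ S, g a = c → f a = d := by
    intro c
    by_cases hc : ∃ a ∈ S, g a = c
    · obtain ⟨a, ha, rfl⟩ := hc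
      exact ⟨f a, fun b hb hh => h b hb a ha hh⟩
    · exact ⟨f s, fun a ha hh => absurd ⟨a, ha, hh⟩ hc⟩
  choose k hk using key
  have : f '' S ⊆ k '' (g '' S) := by
    rintro _ ⟨a, ha, rfl⟩
    exact ⟨g a, ⟨a, ha, rfl⟩, (hk _ a ha rfl).symm⟩
  exact (Set.ncard_le_ncard this ((hS.image g).image k)).trans (Set.ncard_image_le (hS.image g))

/-- multiplying by a transposition splits off a fixed point -/
theorem cycles_split (σ : Equiv.Perm ℤ) (S : Finset ℤ) (x y : ℤ) (hx : x ∈ S) (hy : y ∈ S)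
    (hxy : x ≠ y) (h : σ x = y) :
    cyclesOn (σ * Equiv.swap x y) S = cyclesOn σ S + 1 := by
  set τ := σ * Equiv.swap x y with hτ
  have tx : τ x = σ y := by simp [hτ]
  have ty : τ y = y := by simp [hτ, h]
  have tto : ∀ a, a ≠ x → a ≠ y → τ a = σ a := by
    intro a h1 h2
    simp [hτ, Equiv.swap_apply_of_ne_of_ne h1 h2]
  have d1 : ∀ a b, τ.SameCycle a b → σ.SameCycle a b := by
    intro a b hab
    refine sc_lift τ σ id ?_ hab
    intro a
    simp only [id]
    by_cases h1 : a = x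
    · rw [h1, tx, ← h]
      simp
    by_cases h2 : a = y
    · rw [h2, ty]
    rw [tto a h1 h2]
    simp
  have d2 : ∀ a b, a ≠ y → b ≠ y → σ.SameCycle a b → τ.SameCycle a b := by
    intro a b ha hb hab
    have := sc_lift σ τ (fun a => if a = y then x else a) ?_ hab
    · simpa [ha, hb] using this
    intro a
    by_cases h1 : a = x
    · subst h1
      simp [hxy, h]
    by_cases h2 : a = y
    · subst h2
      have : σ a ≠ a := fun hh => hxy (σ.injective (h.trans hh.symm))
      simp only [if_true, if_neg this]
      rw [← tx]
      simp
    · have : σ a ≠ y := fun hh => h1 (σ.injective (hh.trans h.symm))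
      simp only [if_neg h2, if_neg this]
      rw [← tto a h1 h2]
      simp
  have d3 : ∀ a, τ.SameCycle y a → a = y := by
    intro a ha
    obtain ⟨k, hk⟩ := ha
    rw [Equiv.Perm.zpow_apply_eq_self_of_apply_eq_self ty] at hk
    exact hk.symm
  let T : Set ℤ := (S : Set ℤ) \ {y}
  have hTf : T.Finite := S.finite_toSet.subset Set.diff_subset
  have e1 : cyclesOn σ S = ((fun a => {b | σ.SameCycle a b}) '' T).ncard := by
    unfold cyclesOn
    congr 1
    apply Set.Subset.antisymm
    · rintro _ ⟨a, ha, rfl⟩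
      by_cases hay : a = y
      · subst hay
        refine ⟨x, ⟨hx, hxy⟩, ?_⟩
        simp only [cls_eq]
        rw [← h]
        simp
      · exact ⟨a, ⟨ha, hay⟩, rfl⟩
    · exact Set.image_mono Set.diff_subset
  have e2 : cyclesOn τ S = ((fun a => {b | τ.SameCycle a b}) '' T).ncard + 1 := by
    unfold cyclesOn
    have : (S : Set ℤ) = insert y T := by
      simp only [T]
      rw [Set.insert_diff_singleton, Set.insert_eq_of_mem]
      exact hy
    rw [this, Set.image_insert_eq, Set.ncard_insert_of_notMem _ (hTf.image _)]
    rintro ⟨a, ha, hh⟩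
    simp only [cls_eq] at hh
    exact ha.2 (d3 a hh.symm)
  rw [e1, e2]
  congr 1
  apply le_antisymm
  · apply ncard_le_of_ker _ hTf
    intro a ha b hb hh
    simp only [cls_eq] at hh ⊢
    exact d2 a b ha.2 hb.2 hh
  · apply ncard_le_of_ker _ hTf
    intro a ha b hb hh
    simp only [cls_eq] at hh ⊢
    exact d1 a b hh

theorem pairing_mem {π : Equiv.Perm ℤ} {S : Finset ℤ} (h : IsPairingOn π S) (a : ℤ) :
    π a ∈ S ↔ a ∈ S := by
  obtain ⟨h1, h2, h3⟩ := h
  have hi : ∀ a, π (π a) = a := fun a => by rw [← Equiv.Perm.mul_apply, h1]; rfl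
  constructor
  · intro hh
    by_contra hc
    rw [h3 a hc] at hh
    exact hc hh
  · intro hh
    by_contra hc
    have := h3 _ hc
    rw [hi] at this
    rw [← this] at hc
    exact hc hh

theorem openers_card {π : Equiv.Perm ℤ} {S : Finset ℤ} (h : IsPairingOn π S) :
    2 * (S.filter fun a => a < π a).card = S.card := by
  have hm := pairing_mem h
  obtain ⟨h1, h2, h3⟩ := h
  have hi : ∀ a, π (π a) = a := fun a => by rw [← Equiv.Perm.mul_apply, h1]; rfl
  rw [← Finset.card_filter_add_card_filter_not (s := S) (fun a => a < π a), two_mul]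
  congr 1
  apply Finset.card_bij (fun a _ => π a)
  · intro a ha
    simp only [Finset.mem_filter] at ha ⊢
    rw [hi, hm]
    exact ⟨ha.1, by omega⟩
  · intro a _ b _ hh
    exact π.injective hh
  · intro b hb
    simp only [Finset.mem_filter] at hb
    refine ⟨π b, ?_, hi b⟩
    simp only [Finset.mem_filter]
    rw [hi, hm]
    have := h2 b hb.1
    exact ⟨hb.1, by omega⟩

theorem pairing_cycles {π : Equiv.Perm ℤ} {S : Finset ℤ} (h : IsPairingOn π S) :
    2 * cyclesOn π S = S.card := by
  rw [← openers_card h]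
  congr 1
  have hm := pairing_mem h
  obtain ⟨h1, h2, h3⟩ := h
  have hi : ∀ a, π (π a) = a := fun a => by rw [← Equiv.Perm.mul_apply, h1]; rfl
  have sc : ∀ a b, π.SameCycle a b → b = a ∨ b = π a := by
    rintro a b ⟨k, rfl⟩
    induction k using Int.induction_on with
    | zero => simp
    | succ k ih =>
      rw [add_comm, zpow_one_add, Equiv.Perm.mul_apply]
      rcases ih with ih | ih <;> rw [ih]
      · right; rfl
      · left; exact hi a
    | pred k ih =>
      have e : (π ^ (-(k : ℤ) - 1)) a = π ((π ^ (-(k : ℤ))) a) := by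
        conv_rhs => rw [show (-(k : ℤ)) = 1 + (-(k : ℤ) - 1) by ring, zpow_one_add,
          Equiv.Perm.mul_apply, hi]
      rw [e]
      rcases ih with ih | ih <;> rw [ih]
      · right; rfl
      · left; exact hi a
  unfold cyclesOn
  have : (fun a => {b | π.SameCycle a b}) '' (S : Set ℤ) =
      (fun a => {b | π.SameCycle a b}) '' ((S.filter fun a => a < π a : Finset ℤ) : Set ℤ) := by
    apply Set.Subset.antisymm
    · rintro _ ⟨a, ha, rfl⟩
      by_cases hc : a < π a
      · exact ⟨a, by simpa using ⟨ha, hc⟩, rfl⟩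
      · refine ⟨π a, ?_, ?_⟩
        · simp only [Finset.coe_filter, Set.mem_ofPred_eq]
          rw [hi, hm]
          have := h2 a ha
          exact ⟨ha, by omega⟩
        · simp only [cls_eq]
          exact Equiv.Perm.sameCycle_apply_left.2 (Equiv.Perm.SameCycle.refl _ _)
    · exact Set.image_mono (by intro x hx; simp at hx; exact hx.1)
  rw [this, Set.ncard_image_of_injOn, Set.ncard_coe_finset]
  intro a ha b hb hh
  simp only [cls_eq] at hh
  simp only [Finset.coe_filter, Set.mem_ofPred_eq] at ha hb
  rcases sc a b hh with e | e
  · exact e.symm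
  · rw [e, hi] at hb
    omega

section UV
variable {n : ℕ} {u v : ℤ}

theorem guv_in (h1 : 1 ≤ u) (h2 : u < v) (h3 : v < n) {a : ℤ} (ha : u ≤ a) (hb : a < v) :
    gammaUV n u v a = a + 1 := by
  unfold gammaUV
  rw [Equiv.Perm.mul_apply, Equiv.swap_apply_of_ne_of_ne, gammaZ_lt] <;> (try split_ifs) <;> omega

theorem guv_v (h1 : 1 ≤ u) (h2 : u < v) (h3 : v < n) : gammaUV n u v v = u := by
  unfold gammaUV
  rw [Equiv.Perm.mul_apply, Equiv.swap_apply_right]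
  split_ifs with h
  · rw [gammaZ_last _ (by omega), h]
  · rw [gammaZ_lt] <;> omega

theorem guv_hi (h1 : 1 ≤ u) (h2 : u < v) (h3 : v < n) {a : ℤ} (ha : v < a) (hb : a < n) :
    gammaUV n u v a = a + 1 := by
  unfold gammaUV
  rw [Equiv.Perm.mul_apply, Equiv.swap_apply_of_ne_of_ne, gammaZ_lt] <;> (try split_ifs) <;> omega

theorem guv_lo (h1 : 1 ≤ u) (h2 : u < v) (h3 : v < n) {a : ℤ} (ha : 1 ≤ a) (hb : a < u - 1) :
    gammaUV n u v a = a + 1 := by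
  unfold gammaUV
  rw [Equiv.Perm.mul_apply, Equiv.swap_apply_of_ne_of_ne, gammaZ_lt] <;> (try split_ifs) <;> omega

theorem guv_pred (h1 : 1 < u) (h2 : u < v) (h3 : v < n) : gammaUV n u v (u - 1) = v + 1 := by
  unfold gammaUV
  rw [if_neg (by omega), Equiv.Perm.mul_apply, Equiv.swap_apply_left, gammaZ_lt] <;> omega

theorem guv_sc_in (h1 : 1 ≤ u) (h2 : u < v) (h3 : v < n) (k : ℕ) :
    ∀ a : ℤ, u ≤ a → a + k = v → (gammaUV n u v).SameCycle a v := by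
  induction k with
  | zero => intro a _ h; simp at h; rw [h]
  | succ k ih =>
    intro a ha h
    push_cast at h
    have := ih (a + 1) (by omega) (by omega)
    rw [← guv_in h1 h2 h3 ha (by omega)] at this
    simpa using this

theorem guv_sc_hi (h1 : 1 ≤ u) (h2 : u < v) (h3 : v < n) (k : ℕ) :
    ∀ a : ℤ, v < a → a + k = n → (gammaUV n u v).SameCycle a n := by
  induction k with
  | zero => intro a _ h; simp at h; rw [h]
  | succ k ih =>
    intro a ha h
    push_cast at h
    have := ih (a + 1) (by omega) (by omega)
    rw [← guv_hi h1 h2 h3 ha (by omega)] at this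
    simpa using this

theorem guv_sc_lo (h1 : 1 ≤ u) (h2 : u < v) (h3 : v < n) (k : ℕ) :
    ∀ a : ℤ, 1 ≤ a → a + k = u - 1 → (gammaUV n u v).SameCycle a n := by
  induction k with
  | zero =>
    intro a ha h
    simp at h
    have := guv_sc_hi h1 h2 h3 (n - (v + 1)).toNat (v + 1) (by omega) (by omega)
    rw [← guv_pred (by omega) h2 h3] at this
    rw [h]
    simpa using this
  | succ k ih =>
    intro a ha h
    push_cast at h
    have := ih (a + 1) (by omega) (by omega)
    rw [← guv_lo h1 h2 h3 ha (by omega)] at this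
    simpa using this

theorem guv_in' (h1 : 1 ≤ u) (h2 : u < v) (h3 : v < n) {a : ℤ} (ha : u ≤ a ∧ a ≤ v) :
    (gammaUV n u v).SameCycle a v :=
  guv_sc_in h1 h2 h3 (v - a).toNat a ha.1 (by omega)

theorem guv_out' (h1 : 1 ≤ u) (h2 : u < v) (h3 : v < n) {a : ℤ} (ha : a ∈ posSet n)
    (hb : ¬(u ≤ a ∧ a ≤ v)) : (gammaUV n u v).SameCycle a n := by
  simp only [posSet, Finset.mem_Icc] at ha
  by_cases hc : a < u
  · exact guv_sc_lo h1 h2 h3 (u - 1 - a).toNat a ha.1 (by omega)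
  · exact guv_sc_hi h1 h2 h3 (n - a).toNat a (by omega) (by omega)

theorem guv_cycles (h1 : 1 ≤ u) (h2 : u < v) (h3 : v < n) :
    cyclesOn (gammaUV n u v) (posSet n) = 2 := by
  unfold cyclesOn
  have : (fun a => {b | (gammaUV n u v).SameCycle a b}) '' (posSet n : Set ℤ) =
      {{b | (gammaUV n u v).SameCycle v b}, {b | (gammaUV n u v).SameCycle n b}} := by
    apply Set.Subset.antisymm
    · rintro _ ⟨a, ha, rfl⟩
      simp only [Set.mem_insert_iff, Set.mem_singleton_iff, cls_eq]
      by_cases hc : u ≤ a ∧ a ≤ v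
      · exact Or.inl (guv_in' h1 h2 h3 hc)
      · exact Or.inr (guv_out' h1 h2 h3 ha hc)
    · rintro _ (rfl | rfl)
      · exact ⟨v, by simp [posSet]; omega, rfl⟩
      · exact ⟨n, by simp [posSet]; omega, rfl⟩
  rw [this, Set.ncard_pair]
  rw [Ne, cls_eq]
  intro hc
  have := sc_invariant (gammaUV n u v) (Finset.Icc u v) ?_ hc (by simp; omega)
  · simp at this; omega
  · intro a ha
    simp only [Finset.mem_Icc] at ha ⊢
    by_cases hav : a = v
    · rw [hav, guv_v h1 h2 h3]; omega
    · rw [guv_in h1 h2 h3 ha.1 (by omega)]; omega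

end UV

theorem split_count {n : ℕ} {u v : ℤ} (h1 : 1 ≤ u) (h2 : u < v) (h3 : v < n)
    {π : Equiv.Perm ℤ} (hp : IsPairingOn π (posSet n)) (huv : π u = v) :
    cyclesOn (π⁻¹ * gammaUV n u v) (posSet n) =
      cyclesOn (π⁻¹ * gammaZ n) (posSet n) + 1 := by
  unfold gammaUV
  rw [← mul_assoc]
  have hinv : π⁻¹ = π := by
    rw [inv_eq_iff_mul_eq_one]; exact hp.1
  apply cycles_split
  · simp only [posSet, Finset.mem_Icc]; split_ifs <;> omega
  · simp only [posSet, Finset.mem_Icc]; omega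
  · split_ifs <;> omega
  · rw [hinv, Equiv.Perm.mul_apply]
    split_ifs with h
    · rw [gammaZ_last _ (by omega), ← h, huv]
    · rw [gammaZ_lt _ _ (by omega) (by omega)]
      simpa using huv

/-- a pairing all of whose arcs are invariant has many faces -/
theorem nc_count {n : ℕ} (hn : 0 < n) {π : Equiv.Perm ℤ} (hp : IsPairingOn π (posSet n))
    (hinvar : ∀ u, 1 ≤ u → u < π u → ∀ a, u ≤ a → a ≤ π u → u ≤ π a ∧ π a ≤ π u) :
    n + 2 ≤ 2 * cyclesOn (π⁻¹ * gammaZ n) (posSet n) := by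
  have hinv : π⁻¹ = π := by
    rw [inv_eq_iff_mul_eq_one]; exact hp.1
  rw [hinv]
  have ho := openers_card hp
  have hm := pairing_mem hp
  have hcard : (posSet n).card = n := by simp [posSet]
  rw [hcard] at ho
  have hi : ∀ a, π (π a) = a := fun a => by rw [← Equiv.Perm.mul_apply, hp.1]; rfl
  simp only [posSet, Finset.mem_Icc] at hm
  set O := (posSet n).filter fun a => a < π a with hO
  have memO : ∀ a, a ∈ O ↔ (1 ≤ a ∧ a ≤ n) ∧ a < π a := by
    intro a; simp [hO, posSet]
  have key : ∀ u ∈ O, ∀ b, (π * gammaZ n).SameCycle u b → u ≤ b ∧ b < π u := by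
    intro u hu b hub
    rw [memO] at hu
    have hr := (hm u).2 hu.1
    have := sc_invariant (π * gammaZ n) (Finset.Ico u (π u)) ?_ hub (by simp; omega)
    · simpa using this
    intro a ha
    simp only [Finset.mem_Ico] at ha ⊢
    rw [Equiv.Perm.mul_apply, gammaZ_lt _ _ (by omega) (by omega)]
    have h := hinvar u hu.1.1 hu.2 (a + 1) (by omega) (by omega)
    have : π (a + 1) ≠ π u := fun hh => by have := π.injective hh; omega
    omega
  have hnO : (n : ℤ) ∉ O := by
    rw [memO]
    intro h
    have := (hm n).2 h.1
    omega
  have hsub : (fun a => {b | (π * gammaZ n).SameCycle a b}) '' ((insert (n : ℤ) O : Finset ℤ) : Set ℤ)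
      ⊆ (fun a => {b | (π * gammaZ n).SameCycle a b}) '' (posSet n : Set ℤ) := by
    apply Set.image_mono
    intro a ha
    simp only [Finset.coe_insert, Set.mem_insert_iff, Finset.mem_coe, memO] at ha
    simp only [posSet, Finset.mem_coe, Finset.mem_Icc]
    omega
  have hle := Set.ncard_le_ncard hsub ((posSet n).finite_toSet.image _)
  rw [Set.ncard_image_of_injOn, Set.ncard_coe_finset, Finset.card_insert_of_notMem hnO] at hle
  · unfold cyclesOn
    omega
  · intro a ha b hb hh
    simp only [cls_eq] at hh
    simp only [Finset.coe_insert, Set.mem_insert_iff, Finset.mem_coe] at ha hb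
    have bd : ∀ u ∈ O, π u ≤ n := fun u hu => ((hm u).2 ((memO u).1 hu).1).2
    rcases ha with rfl | ha <;> rcases hb with rfl | hb
    · rfl
    · have := key b hb _ hh.symm
      have := bd b hb
      omega
    · have := key a ha _ hh
      have := bd a ha
      omega
    · have := key a ha _ hh
      have := key b hb _ hh.symm
      omega

theorem guv_trans {n : ℕ} {u v : ℤ} (h1 : 1 ≤ u) (h2 : u < v) (h3 : v < n)
    {π : Equiv.Perm ℤ} {c : ℤ} (hc : u ≤ c ∧ c ≤ v) (hc' : π c ∈ posSet n)
    (hc'' : ¬(u ≤ π c ∧ π c ≤ v)) :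
    ∀ a ∈ posSet n, ∀ b ∈ posSet n,
      ∃ σ ∈ Subgroup.closure ({π, gammaUV n u v} : Set (Equiv.Perm ℤ)), σ a = b := by
  set H := Subgroup.closure ({π, gammaUV n u v} : Set (Equiv.Perm ℤ)) with hH
  have hπ : π ∈ H := Subgroup.subset_closure (by simp)
  have hg : gammaUV n u v ∈ H := Subgroup.subset_closure (by simp)
  have rs : ∀ a b, (∃ σ ∈ H, σ a = b) → ∃ σ ∈ H, σ b = a := by
    rintro a b ⟨σ, hσ, rfl⟩
    exact ⟨σ⁻¹, H.inv_mem hσ, by simp⟩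
  have rt : ∀ a b c, (∃ σ ∈ H, σ a = b) → (∃ σ ∈ H, σ b = c) → ∃ σ ∈ H, σ a = c := by
    rintro a b c ⟨σ, hσ, rfl⟩ ⟨τ, hτ, rfl⟩
    exact ⟨τ * σ, H.mul_mem hτ hσ, rfl⟩
  have rg : ∀ a b, (gammaUV n u v).SameCycle a b → ∃ σ ∈ H, σ a = b := by
    rintro a b ⟨k, hk⟩
    exact ⟨_, H.zpow_mem hg k, hk⟩
  have hvn : ∃ σ ∈ H, σ v = n :=
    rt v c n (rs _ _ (rg _ _ (guv_in' h1 h2 h3 hc)))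
      (rt c (π c) n ⟨π, hπ, rfl⟩ (rg _ _ (guv_out' h1 h2 h3 hc' hc'')))
  have all : ∀ a ∈ posSet n, ∃ σ ∈ H, σ a = n := by
    intro a ha
    by_cases hh : u ≤ a ∧ a ≤ v
    · exact rt _ _ _ (rg _ _ (guv_in' h1 h2 h3 hh)) hvn
    · exact rg _ _ (guv_out' h1 h2 h3 ha hh)
  intro a ha b hb
  exact rt _ _ _ (all a ha) (rs _ _ (all b hb))

/-- For `n` a positive even integer, `a₁(n) = NC₂^T(n)` as subsets of
`P₂(n)`. -/
theorem a1_eq_ncT2 (n : ℕ) (hn : 0 < n) (hne : Even n) :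
    aSet 1 n = ncT2 n := by
  have hcard : (posSet n).card = n := by simp [posSet]
  obtain ⟨m, hm⟩ := hne
  ext π
  constructor
  · rintro ⟨hp, hc⟩
    have hpc := pairing_cycles hp
    have hmem := pairing_mem hp
    have hi : ∀ a, π (π a) = a := fun a => by rw [← Equiv.Perm.mul_apply, hp.1]; rfl
    have hex : ∃ k : ℕ, 1 ≤ (k : ℤ) ∧ (k : ℤ) < π k ∧
        ∃ a, (k : ℤ) ≤ a ∧ a ≤ π k ∧ ¬((k : ℤ) ≤ π a ∧ π a ≤ π k) := by
      by_contra hcon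
      push Not at hcon
      have := nc_count hn hp ?_
      · omega
      · intro u h1 h2 a h3 h4
        have := hcon u.toNat
        rw [Int.toNat_of_nonneg (by omega)] at this
        by_contra hh
        have := this h1 h2 a h3 h4
        omega
    classical
    obtain ⟨hu1, huv, c, hc1, hc2, hc3⟩ := Nat.find_spec hex
    have hmin : ∀ w : ℤ, 1 ≤ w → w < Nat.find hex → w < π w →
        ∀ a, w ≤ a → a ≤ π w → w ≤ π a ∧ π a ≤ π w := by
      intro w h1 h2 h3 a h4 h5
      have := Nat.find_min hex (m := w.toNat) (by omega)
      rw [Int.toNat_of_nonneg (by omega)] at this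
      by_contra hh
      exact this ⟨h1, h3, a, h4, h5, hh⟩
    generalize ((Nat.find hex : ℕ) : ℤ) = u at *
    have huS : u ∈ posSet n := by
      by_contra hh
      have := hp.2.2 u hh
      omega
    have hvS := (hmem u).2 huS
    simp only [posSet, Finset.mem_Icc] at huS hvS hmem
    have hlow : ∀ a : ℤ, 1 ≤ a → a < u → ¬(u ≤ π a ∧ π a ≤ π u) := by
      intro a h1 h2 h3
      have h := hmin a h1 h2 (by omega) u (by omega) h3.1
      have : π a = π u := by omega
      have := π.injective this
      omega
    have hcS := (hmem c).2 (by omega)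
    have hvn : π u < n := by
      by_contra hh
      refine hlow (π c) hcS.1 (by omega) ?_
      rw [hi]
      exact ⟨hc1, hc2⟩
    refine ⟨u, π u, hu1, huv, hvn, hp, ⟨?_, ?_⟩, rfl, ?_⟩
    · exact guv_trans hu1 huv hvn ⟨hc1, hc2⟩ (by simpa [posSet] using hcS) hc3
    · rw [split_count hu1 huv hvn hp rfl, guv_cycles hu1 huv hvn]
      omega
    · intro a h1 h2
      refine ⟨?_, hlow a h1 h2⟩
      simp only [posSet, Finset.mem_Icc]
      exact (hmem a).2 (by omega)
  · rintro ⟨u, v, h1, h2, h3, hp, ⟨-, hc⟩, huv, -⟩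
    refine ⟨hp, ?_⟩
    have hpc := pairing_cycles hp
    rw [split_count h1 h2 h3 hp huv, guv_cycles h1 h2 h3] at hc
    omega

end RibbonNC
end
end
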